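/- Gaussian product as factored Gaussians in rotated coordinates gives the degenerate limit: for σ > 0, nonzero g ∈ ℝ², x, y, b, z ∈ ℝ², the limit as ε → 0⁺ of ∫_{ℝ^{2×2}} k_ε(z - Aᵀg) k_σ(y - Ax - b) k_{σ†}(A - A₀) dA (convolution of the product of a narrow Gaussian enforcing Aᵀg = z and the spatial Gaussian, with an isotropic Gaussian of width σ† over the four matrix entries, evaluated at A₀) equals k_σ((xᵀz - (y-b)ᵀg)/‖g‖) · k_{√(σ² + σ†²‖x‖²)}(gᵀ(A₀x + b - y)^⊥ / ‖g‖) · k_{σ†‖g‖}(z - A₀ᵀ g), where for u = (u₁,u₂), u^⊥ = (u₂, -u₁) and gᵀv^⊥ denotes the inner product of g with v^⊥. -/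

import Mathlib

open MeasureTheory Filter Matrix RealInnerProductSpace

/-- d-dimensional isotropic Gaussian kernel. -/
noncomputable def gauss (d : ℕ) (σ : ℝ) (v : EuclideanSpace ℝ (Fin d)) : ℝ :=
  (2 * Real.pi * σ ^ 2) ^ (-(d : ℝ) / 2) * Real.exp (-‖v‖ ^ 2 / (2 * σ ^ 2))

/-- 1D Gaussian kernel. -/
noncomputable def gauss1 (σ t : ℝ) : ℝ :=
  (2 * Real.pi * σ ^ 2) ^ (-(1 : ℝ) / 2) * Real.exp (-t ^ 2 / (2 * σ ^ 2))

/-- Isotropic Gaussian over the four entries of a 2×2 matrix. -/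
noncomputable def gaussMat (σ : ℝ) (A : Matrix (Fin 2) (Fin 2) ℝ) : ℝ :=
  (2 * Real.pi * σ ^ 2) ^ (-(2 : ℝ)) * Real.exp (-(∑ i, ∑ j, (A i j) ^ 2) / (2 * σ ^ 2))

/-- Clockwise perpendicular of a planar vector: (u₁,u₂)^⊥ = (u₂,-u₁). -/
noncomputable def perp (u : EuclideanSpace ℝ (Fin 2)) : EuclideanSpace ℝ (Fin 2) :=
  (WithLp.equiv 2 (Fin 2 → ℝ)).symm ![u 1, -u 0]

lemma gauss1_eq (σ t : ℝ) :
    gauss1 σ t = (√(2 * Real.pi * σ ^ 2))⁻¹ * Real.exp (-t ^ 2 / (2 * σ ^ 2)) := by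
  rw [gauss1, neg_div, Real.rpow_neg (by positivity), Real.sqrt_eq_rpow]

lemma gauss1_nonneg (σ t : ℝ) : 0 ≤ gauss1 σ t := by
  rw [gauss1_eq]; positivity

lemma gauss1_le (σ t : ℝ) : gauss1 σ t ≤ gauss1 σ 0 := by
  simp only [gauss1_eq]
  gcongr _ * Real.exp (?_ / _)
  simpa using sq_nonneg t

@[fun_prop]
lemma continuous_gauss1 (σ : ℝ) : Continuous (gauss1 σ) := by
  unfold gauss1
  fun_prop

lemma gauss1_neg (σ t : ℝ) : gauss1 σ (-t) = gauss1 σ t := by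
  simp [gauss1]

lemma gauss1_mul_mul {a : ℝ} (ha : 0 < a) (σ t : ℝ) :
    gauss1 (a * σ) (a * t) = a⁻¹ * gauss1 σ t := by
  have h : 2 * Real.pi * (a * σ) ^ 2 = a ^ 2 * (2 * Real.pi * σ ^ 2) := by ring
  rw [gauss1_eq, gauss1_eq, h, Real.sqrt_mul (by positivity), Real.sqrt_sq ha.le, mul_inv,
    mul_assoc]
  congr 3
  field_simp

lemma gauss1_mul_gauss1_reflection {c s : ℝ} (h : c ^ 2 + s ^ 2 = 1) (σ a b : ℝ) :
    gauss1 σ a * gauss1 σ b = gauss1 σ (c * a + s * b) * gauss1 σ (s * a - c * b) := by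
  simp only [gauss1, mul_mul_mul_comm _ (Real.exp _), ← Real.exp_add, ← add_div]
  congr 3
  linear_combination (a ^ 2 + b ^ 2) * h

lemma gauss_two_eq (σ : ℝ) (v : EuclideanSpace ℝ (Fin 2)) :
    gauss 2 σ v = gauss1 σ (v 0) * gauss1 σ (v 1) := by
  have h : (√(2 * Real.pi * σ ^ 2))⁻¹ * (√(2 * Real.pi * σ ^ 2))⁻¹ =
      (2 * Real.pi * σ ^ 2) ^ (-((2 : ℕ) : ℝ) / 2) := by
    rw [← mul_inv, Real.mul_self_sqrt (by positivity)]
    norm_num [Real.rpow_neg_one]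
  rw [gauss1_eq, gauss1_eq, mul_mul_mul_comm, h, ← Real.exp_add, gauss, EuclideanSpace.norm_sq_eq]
  congr 2
  simp [Fin.sum_univ_two]
  ring

lemma gaussMat_eq (σ : ℝ) (A : Matrix (Fin 2) (Fin 2) ℝ) :
    gaussMat σ A =
      (gauss1 σ (A 0 0) * gauss1 σ (A 0 1)) * (gauss1 σ (A 1 0) * gauss1 σ (A 1 1)) := by
  have h : ((√(2 * Real.pi * σ ^ 2))⁻¹ * (√(2 * Real.pi * σ ^ 2))⁻¹) *
      ((√(2 * Real.pi * σ ^ 2))⁻¹ * (√(2 * Real.pi * σ ^ 2))⁻¹) =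
      (2 * Real.pi * σ ^ 2) ^ (-(2 : ℝ)) := by
    rw [← mul_inv, Real.mul_self_sqrt (by positivity), Real.rpow_neg (by positivity), ← mul_inv]
    norm_cast
    ring_nf
  simp only [gauss1_eq, mul_mul_mul_comm _ (Real.exp _), h, ← Real.exp_add, gaussMat]
  congr 2
  simp [Fin.sum_univ_two]
  ring

lemma integrable_gauss1 {σ : ℝ} (hσ : 0 < σ) : Integrable (gauss1 σ) := by
  have h := (integrable_exp_neg_mul_sq (b := (2 * σ ^ 2)⁻¹) (by positivity)).const_mul
    (√(2 * Real.pi * σ ^ 2))⁻¹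
  refine h.congr (.of_forall fun t => ?_)
  simp only [gauss1_eq]
  congr 2
  ring

lemma integral_gauss1 {σ : ℝ} (hσ : 0 < σ) : ∫ t, gauss1 σ t = 1 := by
  have h : ∀ t, gauss1 σ t =
      (√(2 * Real.pi * σ ^ 2))⁻¹ * Real.exp (-(2 * σ ^ 2)⁻¹ * t ^ 2) := fun t => by
    rw [gauss1_eq]; congr 2; ring
  simp_rw [h]
  rw [integral_const_mul, integral_gaussian, div_inv_eq_mul,
    show Real.pi * (2 * σ ^ 2) = 2 * Real.pi * σ ^ 2 by ring]
  exact inv_mul_cancel₀ (by positivity)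

/-- An affine pull-back of one Gaussian convolved with another one. -/
lemma integral_gauss1_mul_gauss1 {σ τ : ℝ} (hσ : 0 < σ) (hτ : 0 < τ) (u m x : ℝ) :
    ∫ t, gauss1 σ (u - t * x) * gauss1 τ (t - m) =
      gauss1 (√(σ ^ 2 + τ ^ 2 * x ^ 2)) (u - m * x) := by
  set V := σ ^ 2 + τ ^ 2 * x ^ 2 with hV
  have hV0 : 0 < V := by positivity
  set c := (u * x * τ ^ 2 + m * σ ^ 2) / V with hc
  have hsV : 0 < √V := Real.sqrt_pos.2 hV0
  have hnorm : √(2 * Real.pi * σ ^ 2) * √(2 * Real.pi * τ ^ 2) =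
      √(2 * Real.pi * √V ^ 2) * √(2 * Real.pi * (σ * τ / √V) ^ 2) := by
    rw [← Real.sqrt_mul (by positivity), ← Real.sqrt_mul (by positivity)]
    congr 1
    field_simp
  have hexp (t : ℝ) : -(u - t * x) ^ 2 / (2 * σ ^ 2) + -(t - m) ^ 2 / (2 * τ ^ 2) =
      -(u - m * x) ^ 2 / (2 * √V ^ 2) + -(t - c) ^ 2 / (2 * (σ * τ / √V) ^ 2) := by
    rw [div_pow, Real.sq_sqrt hV0.le, hc]
    field_simp
    rw [hV]
    ring
  have key (t : ℝ) : gauss1 σ (u - t * x) * gauss1 τ (t - m) =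
      gauss1 (√V) (u - m * x) * gauss1 (σ * τ / √V) (t - c) := by
    simp only [gauss1_eq, mul_mul_mul_comm _ (Real.exp _), ← Real.exp_add, ← mul_inv, hnorm, hexp]
  simp_rw [key]
  rw [integral_const_mul, integral_sub_right_eq_self (gauss1 (σ * τ / √V)),
    integral_gauss1 (by positivity), mul_one]

lemma integral_fin_two {α E : Type*} [MeasureSpace α] [SigmaFinite (volume : Measure α)]
    [NormedAddCommGroup E] [NormedSpace ℝ E] (f : (Fin 2 → α) → E) :
    ∫ v, f v = ∫ p : α × α, f ![p.1, p.2] :=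
  ((volume_preserving_finTwoArrow α).symm.integral_comp' f).symm

lemma measurePreserving_of_comp_self_eq_id {E : Type*} [NormedAddCommGroup E] [NormedSpace ℝ E]
    [FiniteDimensional ℝ E] [MeasurableSpace E] [BorelSpace E] (μ : Measure E) [μ.IsAddHaarMeasure]
    (L : E →ₗ[ℝ] E) (hL : L ∘ₗ L = LinearMap.id) : MeasurePreserving L μ μ := by
  have hdet : LinearMap.det L * LinearMap.det L = 1 := by
    rw [← LinearMap.det_comp, hL, LinearMap.det_id]
  have habs : |(LinearMap.det L)⁻¹| = 1 := by
    rcases mul_self_eq_one_iff.1 hdet with h | h <;> simp [h]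
  refine ⟨L.continuous_of_finiteDimensional.measurable, ?_⟩
  rw [Measure.map_linearMap_addHaar_eq_smul_addHaar μ (left_ne_zero_of_mul_eq_one hdet), habs]
  simp

/-- Change of variables along the reflection with matrix `!![c, s; s, -c]`, acting on the rows. -/
lemma integral_comp_row_reflection {c s : ℝ} (h : c ^ 2 + s ^ 2 = 1)
    (f : (Fin 2 → Fin 2 → ℝ) → ℝ) :
    ∫ M, f M = ∫ P : Fin 2 → Fin 2 → ℝ, f ![c • P 0 + s • P 1, s • P 0 - c • P 1] := by
  let L : (Fin 2 → Fin 2 → ℝ) →ₗ[ℝ] (Fin 2 → Fin 2 → ℝ) :=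
    { toFun P := ![c • P 0 + s • P 1, s • P 0 - c • P 1]
      map_add' P Q := by
        ext i j; fin_cases i <;> simp <;> ring
      map_smul' r P := by
        ext i j; fin_cases i <;> simp <;> ring }
  have hL : L ∘ₗ L = LinearMap.id := by
    refine LinearMap.ext fun P => ?_
    ext i j
    fin_cases i <;> simp [L]
    · linear_combination P 0 j * h
    · linear_combination P 1 j * h
  have hLL : Function.Involutive L := fun P => LinearMap.congr_fun hL P
  have hmp := measurePreserving_of_comp_self_eq_id volume L hL
  have hemb : MeasurableEmbedding L :=
    (LinearEquiv.ofInvolutive L hLL).toContinuousLinearEquiv.toHomeomorph.measurableEmbedding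
  exact (hmp.integral_comp hemb f).symm

lemma integral_gauss1_mul_gauss1_fin_two {σ τ : ℝ} (hσ : 0 < σ) (hτ : 0 < τ) (u : ℝ)
    (m x : Fin 2 → ℝ) :
    ∫ q : Fin 2 → ℝ, gauss1 σ (u - q 0 * x 0 - q 1 * x 1) *
        (gauss1 τ (q 0 - m 0) * gauss1 τ (q 1 - m 1)) =
      gauss1 (√(σ ^ 2 + τ ^ 2 * (x 0 ^ 2 + x 1 ^ 2))) (u - m 0 * x 0 - m 1 * x 1) := by
  have h_integral : Integrable fun p : ℝ × ℝ => gauss1 σ (u - p.1 * x 0 - p.2 * x 1) *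
      (gauss1 τ (p.1 - m 0) * gauss1 τ (p.2 - m 1)) := by
    refine (((integrable_gauss1 hτ).comp_sub_right (m 0)).mul_prod
      ((integrable_gauss1 hτ).comp_sub_right (m 1))).bdd_mul (c := gauss1 σ 0)
      (Continuous.aestronglyMeasurable (by fun_prop)) (.of_forall fun p => ?_)
    rw [Real.norm_of_nonneg (gauss1_nonneg _ _)]
    exact gauss1_le _ _
  have hτσ : 0 < √(σ ^ 2 + τ ^ 2 * x 1 ^ 2) := by positivity
  rw [integral_fin_two]
  simp only [Matrix.cons_val_zero, Matrix.cons_val_one]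
  rw [Measure.volume_eq_prod, integral_prod _ h_integral]
  have inner (s : ℝ) : ∫ t, gauss1 σ (u - s * x 0 - t * x 1) *
      (gauss1 τ (s - m 0) * gauss1 τ (t - m 1)) =
      gauss1 (√(σ ^ 2 + τ ^ 2 * x 1 ^ 2)) ((u - m 1 * x 1) - s * x 0) * gauss1 τ (s - m 0) := by
    simp_rw [mul_left_comm (gauss1 σ _)]
    rw [integral_const_mul, integral_gauss1_mul_gauss1 hσ hτ, mul_comm]
    congr 2
    ring
  simp_rw [inner]
  rw [integral_gauss1_mul_gauss1 hτσ hτ, Real.sq_sqrt (by positivity)]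
  ring_nf

/-- A narrow planar Gaussian centred on the solution of `n • p = z` acts as an approximate
identity. -/
lemma tendsto_integral_gauss1_mul {n : ℝ} (hn : 0 < n) (z : Fin 2 → ℝ) {F : (Fin 2 → ℝ) → ℝ}
    (hF : Continuous F) {C : ℝ} (hC : ∀ p, ‖F p‖ ≤ C) :
    Tendsto (fun ε : ℝ => ∫ p : Fin 2 → ℝ,
        gauss1 ε (z 0 - n * p 0) * gauss1 ε (z 1 - n * p 1) * F p)
      (nhdsWithin 0 (Set.Ioi 0)) (nhds ((n ^ 2)⁻¹ * F (n⁻¹ • z))) := by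
  let φ : (Fin 2 → ℝ) → ℝ := fun w => gauss1 1 (w 0) * gauss1 1 (w 1)
  have hφ : Continuous φ := by fun_prop
  have hφint : Integrable φ := by
    rw [← (volume_preserving_finTwoArrow ℝ).symm.integrable_comp_emb
      (MeasurableEquiv.measurableEmbedding _)]
    exact (integrable_gauss1 one_pos).mul_prod (integrable_gauss1 one_pos)
  have hφone : ∫ w, φ w = 1 := by
    rw [integral_fin_two]
    simp only [φ, Matrix.cons_val_zero, Matrix.cons_val_one]
    rw [Measure.volume_eq_prod, integral_prod_mul, integral_gauss1 one_pos, mul_one]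
  have hlim : Tendsto (fun ε : ℝ => ∫ w, φ w * F (n⁻¹ • z + (ε / n) • w))
      (nhdsWithin 0 (Set.Ioi 0)) (nhds (∫ w, φ w * F (n⁻¹ • z))) := by
    refine tendsto_integral_filter_of_dominated_convergence (fun w => ‖φ w‖ * C)
      (.of_forall fun ε => Continuous.aestronglyMeasurable (by fun_prop))
      (.of_forall fun ε => .of_forall fun w => ?_) (hφint.norm.mul_const C)
      (.of_forall fun w => ?_)
    · rw [norm_mul]
      gcongr
      exact hC _
    · have : Continuous fun ε : ℝ => φ w * F (n⁻¹ • z + (ε / n) • w) := by fun_prop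
      simpa using (this.tendsto 0).mono_left nhdsWithin_le_nhds
  rw [integral_mul_const, hφone, one_mul] at hlim
  refine (hlim.const_mul (n ^ 2)⁻¹).congr' ?_
  filter_upwards [self_mem_nhdsWithin] with ε hε
  have hε : 0 < ε := hε
  have hscale (w : Fin 2 → ℝ) (i : Fin 2) :
      gauss1 ε (z i - n * (n⁻¹ • z + (ε / n) • w) i) = ε⁻¹ * gauss1 1 (w i) := by
    rw [← gauss1_mul_mul hε, mul_one, ← gauss1_neg ε (ε * w i)]
    congr 1
    simp
    field_simp
    ring
  let f : (Fin 2 → ℝ) → ℝ := fun p => gauss1 ε (z 0 - n * p 0) * gauss1 ε (z 1 - n * p 1) * F p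
  have hs := Measure.integral_comp_smul volume (fun p => f (n⁻¹ • z + p)) (ε / n)
  rw [Module.finrank_fin_fun, abs_of_pos (by positivity), smul_eq_mul,
    eq_inv_mul_iff_mul_eq₀ (by positivity), integral_add_left_eq_self f] at hs
  change _ = ∫ p, f p
  rw [← hs, ← integral_const_mul, ← integral_const_mul]
  congr 1 with w
  simp only [f, φ, hscale]
  field_simp

theorem degenerate_gaussian_limit (σ σd : ℝ) (hσ : 0 < σ) (hσd : 0 < σd)
    (g x y b z : EuclideanSpace ℝ (Fin 2))
    (hg1 : g 0 ≠ 0) (hg2 : g 1 ≠ 0) (hx1 : x 0 ≠ 0) (hx2 : x 1 ≠ 0)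
    (A₀ : Matrix (Fin 2) (Fin 2) ℝ) :
    Tendsto (fun ε : ℝ =>
        ∫ M : Fin 2 → Fin 2 → ℝ,
          gauss 2 ε (z - Matrix.toEuclideanLin (Matrix.of M)ᵀ g)
            * gauss 2 σ (y - Matrix.toEuclideanLin (Matrix.of M) x - b)
            * gaussMat σd (Matrix.of M - A₀))
      (nhdsWithin 0 (Set.Ioi 0))
      (nhds (gauss1 σ ((⟪x, z⟫ - ⟪y - b, g⟫) / ‖g‖)
        * gauss1 (Real.sqrt (σ ^ 2 + σd ^ 2 * ‖x‖ ^ 2))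
            (⟪g, perp (Matrix.toEuclideanLin A₀ x + b - y)⟫ / ‖g‖)
        * gauss 2 (σd * ‖g‖) (z - Matrix.toEuclideanLin A₀ᵀ g))) := by
  have hg : 0 < ‖g‖ := norm_pos_iff.2 fun h => hg1 (by simp [h])
  set n := ‖g‖ with hn
  have hn2 : n ^ 2 = g 0 ^ 2 + g 1 ^ 2 := by
    simp [hn, EuclideanSpace.norm_sq_eq, Fin.sum_univ_two]
  set c := g 0 / n with hc
  set s := g 1 / n with hs
  have hgc : g 0 = n * c := by rw [hc]; field_simp
  have hgs : g 1 = n * s := by rw [hs]; field_simp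
  have hcs : c ^ 2 + s ^ 2 = 1 := by
    rw [hc, hs, div_pow, div_pow, ← add_div, ← hn2, div_self (by positivity)]
  have hx : ‖x‖ ^ 2 = x 0 ^ 2 + x 1 ^ 2 := by
    simp [EuclideanSpace.norm_sq_eq, Fin.sum_univ_two]
  let m : Fin 2 → ℝ := fun j => c * A₀ 0 j + s * A₀ 1 j
  let m' : Fin 2 → ℝ := fun j => s * A₀ 0 j - c * A₀ 1 j
  let α : ℝ := c * (y 0 - b 0) + s * (y 1 - b 1)
  let β : ℝ := s * (y 0 - b 0) - c * (y 1 - b 1)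
  let F : (Fin 2 → ℝ) → ℝ := fun p => gauss1 σ (α - p 0 * x 0 - p 1 * x 1) *
    (gauss1 σd (p 0 - m 0) * gauss1 σd (p 1 - m 1))
  have hFc : Continuous F := by fun_prop
  have hFb (p : Fin 2 → ℝ) : ‖F p‖ ≤ gauss1 σ 0 * (gauss1 σd 0 * gauss1 σd 0) := by
    simp only [F, norm_mul, Real.norm_of_nonneg (gauss1_nonneg _ _)]
    have h := gauss1_nonneg σd
    exact mul_le_mul (gauss1_le _ _) (mul_le_mul (gauss1_le _ _) (gauss1_le _ _) (h _) (h _))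
      (mul_nonneg (h _) (h _)) (gauss1_nonneg _ _)
  have h_integral (ε : ℝ) : ∫ M : Fin 2 → Fin 2 → ℝ,
      gauss 2 ε (z - Matrix.toEuclideanLin (Matrix.of M)ᵀ g)
        * gauss 2 σ (y - Matrix.toEuclideanLin (Matrix.of M) x - b)
        * gaussMat σd (Matrix.of M - A₀) =
      (∫ p : Fin 2 → ℝ, gauss1 ε (z 0 - n * p 0) * gauss1 ε (z 1 - n * p 1) * F p) *
        gauss1 (√(σ ^ 2 + σd ^ 2 * ‖x‖ ^ 2)) (β - m' 0 * x 0 - m' 1 * x 1) := by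
    rw [hx, ← integral_gauss1_mul_gauss1_fin_two hσ hσd, integral_comp_row_reflection hcs,
      integral_fin_two, ← integral_prod_mul, ← Measure.volume_eq_prod]
    congr 1 with ⟨p, q⟩
    have h1 : gauss 2 ε (z - Matrix.toEuclideanLin
        (Matrix.of ![c • p + s • q, s • p - c • q])ᵀ g) =
        gauss1 ε (z 0 - n * p 0) * gauss1 ε (z 1 - n * p 1) := by
      rw [gauss_two_eq]
      congr 2
      · simp [Matrix.mulVec, dotProduct, Fin.sum_univ_two, hgc, hgs]
        linear_combination (n * p 0) * hcs
      · simp [Matrix.mulVec, dotProduct, Fin.sum_univ_two, hgc, hgs]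
        linear_combination (n * p 1) * hcs
    have h2 : gauss 2 σ (y - Matrix.toEuclideanLin
        (Matrix.of ![c • p + s • q, s • p - c • q]) x - b) =
        gauss1 σ (α - p 0 * x 0 - p 1 * x 1) * gauss1 σ (β - q 0 * x 0 - q 1 * x 1) := by
      rw [gauss_two_eq, gauss1_mul_gauss1_reflection hcs]
      congr 2
      · simp [Matrix.mulVec, dotProduct, Fin.sum_univ_two, α]
        linear_combination -(p 0 * x 0 + p 1 * x 1) * hcs
      · simp [Matrix.mulVec, dotProduct, Fin.sum_univ_two, β]
        linear_combination -(q 0 * x 0 + q 1 * x 1) * hcs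
    have h3 : gaussMat σd (Matrix.of ![c • p + s • q, s • p - c • q] - A₀) =
        (gauss1 σd (p 0 - m 0) * gauss1 σd (p 1 - m 1)) *
          (gauss1 σd (q 0 - m' 0) * gauss1 σd (q 1 - m' 1)) := by
      rw [gaussMat_eq, mul_mul_mul_comm, mul_mul_mul_comm (gauss1 σd (p 0 - m 0))]
      congr 1
      · rw [gauss1_mul_gauss1_reflection hcs]
        congr 2
        · simp [m]
          linear_combination p 0 * hcs
        · simp [m']
          linear_combination q 0 * hcs
      · rw [gauss1_mul_gauss1_reflection hcs]
        congr 2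
        · simp [m]
          linear_combination p 1 * hcs
        · simp [m']
          linear_combination q 1 * hcs
    simp only [Matrix.cons_val_zero, Matrix.cons_val_one, h1, h2, h3, F]
    ring
  simp_rw [h_integral]
  have hlim := (tendsto_integral_gauss1_mul hg z hFc hFb).mul_const
    (gauss1 (√(σ ^ 2 + σd ^ 2 * ‖x‖ ^ 2)) (β - m' 0 * x 0 - m' 1 * x 1))
  convert hlim using 2
  have e1 : (⟪x, z⟫ - ⟪y - b, g⟫) / n =
      -(α - (n⁻¹ • z.ofLp) 0 * x 0 - (n⁻¹ • z.ofLp) 1 * x 1) := by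
    simp [PiLp.inner_apply, Fin.sum_univ_two, α, hgc, hgs]
    field_simp
    ring
  have e2 : ⟪g, perp (Matrix.toEuclideanLin A₀ x + b - y)⟫ / n =
      β - m' 0 * x 0 - m' 1 * x 1 := by
    simp [perp, PiLp.inner_apply, Matrix.mulVec, dotProduct, Fin.sum_univ_two, β, m', hgc, hgs]
    field_simp
    ring
  have e3 : gauss 2 (σd * n) (z - Matrix.toEuclideanLin A₀ᵀ g) =
      (n ^ 2)⁻¹ * (gauss1 σd ((n⁻¹ • z.ofLp) 0 - m 0) * gauss1 σd ((n⁻¹ • z.ofLp) 1 - m 1)) := by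
    rw [gauss_two_eq, sq, mul_inv, mul_mul_mul_comm, ← gauss1_mul_mul hg, ← gauss1_mul_mul hg,
      mul_comm σd]
    congr 2
    · simp [Matrix.mulVec, dotProduct, Fin.sum_univ_two, m, hgc, hgs]
      field_simp
    · simp [Matrix.mulVec, dotProduct, Fin.sum_univ_two, m, hgc, hgs]
      field_simp
  rw [e1, e2, e3, gauss1_neg]
  simp only [F]
  ring
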